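/- Let Ω be a nonempty open proper subset of ℝⁿ, let μ ∈ (0,∞] and ν ≥ 2μ (with ν = ∞ allowed). There is a constant C > 0, depending only on n, such that for every f ∈ L¹_loc(Ω) with [f]_{BMO^μ(Ω)} + [f]_{b^ν} < ∞, the zero extension f₀ of f to ℝⁿ (f₀ = f on Ω, f₀ = 0 on Ωᶜ) satisfies [f₀]_{BMO^μ(ℝⁿ)} ≤ C·( [f]_{BMO^μ(Ω)} + [f]_{b^ν} ). -/

import Mathlib

open MeasureTheory Metric ENNReal

/-- The `BMO^μ(Ω)` seminorm: supremum of mean oscillations over closed balls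
contained in `Ω` of radius `r < μ`. -/
noncomputable def bmoSemi {n : ℕ} (Ω : Set (EuclideanSpace ℝ (Fin n))) (μ : ℝ≥0∞)
    (f : EuclideanSpace ℝ (Fin n) → ℝ) : ℝ≥0∞ :=
  ⨆ (x : EuclideanSpace ℝ (Fin n)) (r : ℝ) (_ : 0 < r) (_ : ENNReal.ofReal r < μ)
    (_ : closedBall x r ⊆ Ω),
    (volume (closedBall x r))⁻¹ *
      ∫⁻ y in closedBall x r, ENNReal.ofReal |f y - ⨍ z in closedBall x r, f z|

/-- The uniformly local `L¹` norm over a set `S` (with ball radius `1`). -/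
noncomputable def ulNorm {n : ℕ} (S : Set (EuclideanSpace ℝ (Fin n)))
    (f : EuclideanSpace ℝ (Fin n) → ℝ) : ℝ≥0∞ :=
  ⨆ x : EuclideanSpace ℝ (Fin n), ∫⁻ y in S ∩ closedBall x 1, ENNReal.ofReal |f y|

/-- The boundary seminorm `[f]_{b^ν}`. -/
noncomputable def bSemi {n : ℕ} (Ω : Set (EuclideanSpace ℝ (Fin n))) (ν : ℝ≥0∞)
    (f : EuclideanSpace ℝ (Fin n) → ℝ) : ℝ≥0∞ :=
  ⨆ (x : EuclideanSpace ℝ (Fin n)) (_ : x ∈ frontier Ω) (r : ℝ) (_ : 0 < r)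
    (_ : ENNReal.ofReal r < ν),
    (ENNReal.ofReal (r ^ n))⁻¹ * ∫⁻ y in Ω ∩ closedBall x r, ENNReal.ofReal |f y|

/-- The tubular neighborhood `Γ_δ = {x ∈ Ω | d_Ω(x) < δ}` of the boundary inside `Ω`. -/
def tub {n : ℕ} (Ω : Set (EuclideanSpace ℝ (Fin n))) (δ : ℝ≥0∞) :
    Set (EuclideanSpace ℝ (Fin n)) :=
  {x ∈ Ω | ENNReal.ofReal (Metric.infDist x (frontier Ω)) < δ}

/-- A preconnected set meeting both a set and its complement meets the frontier. -/
theorem IsPreconnected.inter_frontier_nonempty {X : Type*} [TopologicalSpace X] {s t : Set X}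
    (hs : IsPreconnected s) (h : (s ∩ t).Nonempty) (h' : (s ∩ tᶜ).Nonempty) :
    (s ∩ frontier t).Nonempty := by
  by_contra h_empty
  have h_cover : ∀ y ∈ s, y ∈ closure t → y ∈ interior t := fun y hy hyc => by
    by_contra hyi
    exact h_empty ⟨y, hy, hyc, hyi⟩
  obtain ⟨a, has, hat⟩ := h
  obtain ⟨b, hbs, hbt⟩ := h'
  obtain ⟨c, _, hci, hcc⟩ := hs (interior t) (closure t)ᶜ isOpen_interior
    isClosed_closure.isOpen_compl
    (fun y hy => (em (y ∈ closure t)).imp (h_cover y hy) id)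
    ⟨a, has, h_cover a has (subset_closure hat)⟩
    ⟨b, hbs, fun hb => hbt (interior_subset (h_cover b hbs hb))⟩
  exact hcc (subset_closure (interior_subset hci))

/-- The integral of the oscillation over a set is at most twice the `L¹` norm. -/
theorem lintegral_abs_sub_setAverage_le {α : Type*} [MeasurableSpace α] {m : Measure α} {B : Set α}
    (g : α → ℝ) :
    ∫⁻ y in B, ENNReal.ofReal |g y - ⨍ z in B, g z ∂m| ∂m ≤
      2 * ∫⁻ y in B, ENNReal.ofReal |g y| ∂m := by
  set a : ℝ := ⨍ z in B, g z ∂m with ha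
  have h_avg : ENNReal.ofReal |a| * m B ≤ ∫⁻ y in B, ENNReal.ofReal |g y| ∂m := by
    have h1 : ENNReal.ofReal |a| ≤ (m B)⁻¹ * ∫⁻ y in B, ENNReal.ofReal |g y| ∂m := by
      simp only [← Real.enorm_eq_ofReal_abs]
      rw [ha, average]
      refine (enorm_integral_le_lintegral_enorm _).trans_eq ?_
      rw [lintegral_smul_measure, Measure.restrict_apply_univ, smul_eq_mul]
    calc ENNReal.ofReal |a| * m B
        ≤ (m B)⁻¹ * (∫⁻ y in B, ENNReal.ofReal |g y| ∂m) * m B := by gcongr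
      _ = ((m B)⁻¹ * m B) * ∫⁻ y in B, ENNReal.ofReal |g y| ∂m := by ring
      _ ≤ 1 * ∫⁻ y in B, ENNReal.ofReal |g y| ∂m := by
          gcongr
          exact ENNReal.inv_mul_le_one _
      _ = _ := one_mul _
  calc ∫⁻ y in B, ENNReal.ofReal |g y - a| ∂m
      ≤ ∫⁻ y in B, (ENNReal.ofReal |g y| + ENNReal.ofReal |a|) ∂m := by
        refine lintegral_mono fun y => ?_
        rw [← ENNReal.ofReal_add (abs_nonneg _) (abs_nonneg _)]
        exact ENNReal.ofReal_le_ofReal (abs_sub _ _)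
    _ = (∫⁻ y in B, ENNReal.ofReal |g y| ∂m) + ENNReal.ofReal |a| * m B := by
        rw [lintegral_add_right _ measurable_const, setLIntegral_const]
    _ ≤ 2 * ∫⁻ y in B, ENNReal.ofReal |g y| ∂m := by
        rw [two_mul]
        gcongr

/-- The mean of `|f|` over the part in `Ω` of a ball meeting the boundary is controlled by the
boundary seminorm. -/
theorem setLIntegral_inter_closedBall_le_bSemi {n : ℕ} {Ω : Set (EuclideanSpace ℝ (Fin n))}
    {ν : ℝ≥0∞} (f : EuclideanSpace ℝ (Fin n) → ℝ) {x p : EuclideanSpace ℝ (Fin n)} {r : ℝ}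
    (hr : 0 < r) (hrν : ENNReal.ofReal (2 * r) < ν) (hp : p ∈ frontier Ω)
    (hpx : p ∈ closedBall x r) :
    ∫⁻ y in Ω ∩ closedBall x r, ENNReal.ofReal |f y| ≤
      ENNReal.ofReal ((2 * r) ^ n) * bSemi Ω ν f := by
  have h_sub : closedBall x r ⊆ closedBall p (2 * r) := by
    refine closedBall_subset_closedBall' ?_
    rw [mem_closedBall'] at hpx
    linarith
  have h_pos : 0 < (2 * r) ^ n := by positivity
  have h_le : (ENNReal.ofReal ((2 * r) ^ n))⁻¹ *
      ∫⁻ y in Ω ∩ closedBall p (2 * r), ENNReal.ofReal |f y| ≤ bSemi Ω ν f :=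
    le_iSup₂_of_le p hp <| le_iSup₂_of_le (2 * r) (by positivity) <| le_iSup_of_le hrν le_rfl
  refine (lintegral_mono_set (Set.inter_subset_inter_right Ω h_sub)).trans ?_
  rwa [← ENNReal.inv_mul_le_iff (by simpa using h_pos) ENNReal.ofReal_ne_top]

/-- zero extension of a `BMO_b^{μ,ν}` function (with `ν ≥ 2μ`) is in
`BMO^μ(ℝⁿ)`, with a constant depending only on `n`. -/
theorem zero_extension_bmo (n : ℕ) :
    ∃ C : ℝ, 0 < C ∧
      ∀ (Ω : Set (EuclideanSpace ℝ (Fin n))), Ω.Nonempty → IsOpen Ω → Ω ≠ Set.univ →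
        ∀ (μ ν : ℝ≥0∞), 0 < μ → 2 * μ ≤ ν →
          ∀ f : EuclideanSpace ℝ (Fin n) → ℝ, LocallyIntegrableOn f Ω →
            bmoSemi Ω μ f + bSemi Ω ν f < ⊤ →
            bmoSemi Set.univ μ (Set.indicator Ω f) ≤
              ENNReal.ofReal C * (bmoSemi Ω μ f + bSemi Ω ν f) := by
  set V : ℝ≥0∞ := volume (ball (0 : EuclideanSpace ℝ (Fin n)) 1) with hV
  have hV0 : V ≠ 0 := (measure_ball_pos volume _ one_pos).ne'
  have hVt : V ≠ ⊤ := measure_ball_lt_top.ne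
  have hK : V⁻¹ * (2 * 2 ^ n) ≠ ⊤ := by finiteness
  refine ⟨1 + (V⁻¹ * (2 * 2 ^ n)).toReal, by positivity, ?_⟩
  intro Ω _ hΩo _ μ ν _ hμν f _ _
  rw [ENNReal.ofReal_add zero_le_one ENNReal.toReal_nonneg, ENNReal.ofReal_toReal hK,
    ENNReal.ofReal_one]
  refine iSup₂_le fun x r => iSup₂_le fun hr hrμ => iSup_le fun _ => ?_
  by_cases h_sub : closedBall x r ⊆ Ω
  · have h_eq : Set.EqOn (Ω.indicator f) f (closedBall x r) := fun y hy =>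
      Set.indicator_of_mem (h_sub hy) f
    have h_avg : ⨍ z in closedBall x r, Ω.indicator f z = ⨍ z in closedBall x r, f z :=
      setAverage_congr_fun measurableSet_closedBall (.of_forall h_eq)
    rw [h_avg, setLIntegral_congr_fun measurableSet_closedBall
      (fun y hy => by simp only [h_eq hy] :
        Set.EqOn _ (fun y => ENNReal.ofReal |f y - ⨍ z in closedBall x r, f z|) _)]
    calc _ ≤ bmoSemi Ω μ f :=
          le_iSup₂_of_le x r <| le_iSup₂_of_le hr hrμ <| le_iSup_of_le h_sub le_rfl
      _ ≤ 1 * (bmoSemi Ω μ f + bSemi Ω ν f) := by rw [one_mul]; exact le_self_add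
      _ ≤ _ := by gcongr; exact le_self_add
  have h_osc := lintegral_abs_sub_setAverage_le (m := volume) (B := closedBall x r)
    (Ω.indicator f)
  have h_ind : ∫⁻ y in closedBall x r, ENNReal.ofReal |Ω.indicator f y| =
      ∫⁻ y in Ω ∩ closedBall x r, ENNReal.ofReal |f y| := by
    rw [← Measure.restrict_restrict hΩo.measurableSet, ← lintegral_indicator hΩo.measurableSet]
    refine lintegral_congr fun y => ?_
    by_cases hy : y ∈ Ω <;> simp [hy]
  have h_bound : ∫⁻ y in Ω ∩ closedBall x r, ENNReal.ofReal |f y| ≤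
      ENNReal.ofReal ((2 * r) ^ n) * bSemi Ω ν f := by
    rcases (Ω ∩ closedBall x r).eq_empty_or_nonempty with h_empty | h_meet
    · simp [h_empty]
    · obtain ⟨p, hpx, hp⟩ : (closedBall x r ∩ frontier Ω).Nonempty :=
        (convex_closedBall x r).isPreconnected.inter_frontier_nonempty
          (by rwa [Set.inter_comm]) (by rwa [Set.inter_compl_nonempty_iff])
      refine setLIntegral_inter_closedBall_le_bSemi f hr (lt_of_lt_of_le ?_ hμν) hp hpx
      rw [ENNReal.ofReal_mul zero_le_two, ENNReal.ofReal_ofNat]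
      exact (ENNReal.mul_lt_mul_iff_right two_ne_zero ENNReal.ofNat_ne_top).2 hrμ
  have h_vol : volume (closedBall x r) = ENNReal.ofReal (r ^ n) * V := by
    rw [Measure.addHaar_closedBall _ _ hr.le, finrank_euclideanSpace_fin]
  have h0 : ENNReal.ofReal (r ^ n) ≠ 0 := by
    simpa using pow_pos hr n
  rw [h_ind] at h_osc
  calc _ ≤ (ENNReal.ofReal (r ^ n) * V)⁻¹ *
        (2 * (ENNReal.ofReal ((2 * r) ^ n) * bSemi Ω ν f)) := by
        rw [h_vol]
        gcongr
        exact h_osc.trans (by gcongr)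
    _ = ((ENNReal.ofReal (r ^ n))⁻¹ * ENNReal.ofReal (r ^ n)) *
        (V⁻¹ * (2 * 2 ^ n)) * bSemi Ω ν f := by
        rw [ENNReal.mul_inv (.inl h0) (.inl ENNReal.ofReal_ne_top), mul_pow,
          ENNReal.ofReal_mul (by positivity), ENNReal.ofReal_pow zero_le_two,
          ENNReal.ofReal_ofNat]
        ring
    _ = (V⁻¹ * (2 * 2 ^ n)) * bSemi Ω ν f := by
        rw [ENNReal.inv_mul_cancel h0 ENNReal.ofReal_ne_top, one_mul]
    _ ≤ _ := by
        gcongr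
        · exact le_add_self
        · exact le_add_self
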